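/- Let (P,p,k) be a commutative noetherian local ring and P → Q a homomorphism of commutative rings such that Q is a finite free P-module, and suppose there exists a prime ideal q of P for which the ring k(q) ⊗_P Q is Gorenstein, where k(q) = P_q/qP_q. Set R = Q/pQ. If Ext^1_R(Hom_k(R,k), R) = 0, then the ring R is Gorenstein and the P-algebra Q is Frobenius. -/

import Mathlib

open CategoryTheory TensorProduct

noncomputable section

/-- `R` has finite injective dimension as a module over itself, expressed by the
eventual vanishing of `Ext^i(-, R)`. -/
def HasFiniteSelfInjDim (R : Type) [CommRing R] : Prop :=
  ∃ n : ℕ, ∀ (M : ModuleCat R) (i : ℕ), n < i →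
    Limits.IsZero (((Ext R (ModuleCat R) i).obj (Opposite.op M)).obj (ModuleCat.of R R))

/-- A commutative ring is Gorenstein if each of its localizations at primes has finite
injective dimension over itself. -/
def IsGorensteinRing (S : Type) [CommRing S] : Prop :=
  ∀ (q : Ideal S) (hq : q.IsPrime),
    letI := hq
    HasFiniteSelfInjDim (Localization.AtPrime q)

/-- The `P`-algebra `Q` is Frobenius: `Q` is a finite free `P`-module and
`Hom_P(Q, P) ≅ Q` as `Q`-modules, where `Hom_P(Q, P)` carries the `Q`-action
`(x • φ) y = φ (x * y)`; equivalently, the map `x ↦ φ(x * -)` is bijective for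
some `φ : Q →ₗ[P] P`. -/
def IsFrobeniusAlgebra (P Q : Type) [CommRing P] [CommRing Q] [Algebra P Q] : Prop :=
  Module.Finite P Q ∧ Module.Free P Q ∧
  ∃ φ : Q →ₗ[P] P, Function.Bijective fun x : Q => φ ∘ₗ LinearMap.mulLeft P x

/-- The module structure `(x • φ) y = φ (x * y)` on `Hom_k(A, k)` for a commutative
`k`-algebra `A`. -/
instance dualModule (k A : Type) [CommRing k] [CommRing A] [Algebra k A] :
    Module A (A →ₗ[k] k) where
  smul a f := f ∘ₗ LinearMap.mulLeft k a
  one_smul f := by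
    ext x
    show f (1 * x) = f x
    rw [one_mul]
  mul_smul a b f := by
    ext x
    show f ((a * b) * x) = f (b * (a * x))
    congr 1; ring
  smul_zero a := by ext x; rfl
  smul_add a f g := by ext x; rfl
  add_smul a b f := by
    ext x
    show f ((a + b) * x) = f (a * x) + f (b * x)
    rw [add_mul, map_add]
  zero_smul f := by
    ext x
    show f (0 * x) = 0
    rw [zero_mul, map_zero]

section ExtVanishing

variable {S : Type} [CommRing S]

lemma isZero_ext_succ_iff (M N : ModuleCat S) (n : ℕ) :
    Limits.IsZero (((Ext S (ModuleCat S) (n + 1)).obj (Opposite.op M)).obj N) ↔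
      Subsingleton (Abelian.Ext M N (n + 1)) := by
  let C := projectiveResolution M
  rw [(C.isoExt (R := S) (n + 1) N).isZero_iff,
    ← HomologicalComplex.exactAt_iff_isZero_homology,
    HomologicalComplex.exactAt_iff' _ n (n + 1) (n + 2) (by simp) (by simp),
    ShortComplex.moduleCat_exact_iff]
  constructor
  · intro h
    refine subsingleton_of_forall_eq 0 fun α ↦ ?_
    obtain ⟨f, hf, rfl⟩ := C.extMk_surjective α (n + 2) rfl
    obtain ⟨g, hg⟩ := h f hf
    exact (C.extMk_eq_zero_iff f (n + 2) rfl hf n rfl).2 ⟨g, hg⟩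
  · intro h f hf
    exact (C.extMk_eq_zero_iff f (n + 2) rfl hf n rfl).1 (Subsingleton.elim _ _)

lemma shortExact_of_exact {X Y Z : Type} [AddCommGroup X] [AddCommGroup Y] [AddCommGroup Z]
    [Module S X] [Module S Y] [Module S Z] (f : X →ₗ[S] Y) (g : Y →ₗ[S] Z)
    (hf : Function.Injective f) (hg : Function.Surjective g) (hfg : Function.Exact f g) :
    (ShortComplex.mk (ModuleCat.ofHom f) (ModuleCat.ofHom g)
      (by ext x; exact hfg.apply_apply_eq_zero x)).ShortExact := by
  refine ShortComplex.ShortExact.mk' ?_ ?_ ?_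
  · rw [ShortComplex.ShortExact.moduleCat_exact_iff_function_exact]
    exact hfg
  · exact (ModuleCat.mono_iff_injective _).2 hf
  · exact (ModuleCat.epi_iff_surjective _).2 hg

lemma exists_extension_of_subsingleton_ext {M N X : Type} [AddCommGroup M] [AddCommGroup N]
    [AddCommGroup X] [Module S M] [Module S N] [Module S X]
    (h : Subsingleton (Abelian.Ext (ModuleCat.of S M) (ModuleCat.of S N) 1))
    (g : X →ₗ[S] M) (hg : Function.Surjective g) (u : LinearMap.ker g →ₗ[S] N) :
    ∃ v : X →ₗ[S] N, v ∘ₗ (LinearMap.ker g).subtype = u := by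
  have hT := shortExact_of_exact (LinearMap.ker g).subtype g Subtype.val_injective hg
    (LinearMap.exact_subtype_ker_map g)
  obtain ⟨y, hy⟩ := Abelian.Ext.contravariant_sequence_exact₁ hT (ModuleCat.of S N)
    (Abelian.Ext.mk₀ (ModuleCat.ofHom u)) (n₁ := 1) rfl (h.elim _ _)
  obtain ⟨y, rfl⟩ := Abelian.Ext.mk₀_bijective _ _ |>.surjective y
  rw [Abelian.Ext.mk₀_comp_mk₀] at hy
  have := (Abelian.Ext.mk₀_bijective _ _).injective hy
  exact ⟨y.hom, by ext x; exact LinearMap.congr_fun (congrArg ModuleCat.Hom.hom this) x⟩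

lemma hasFiniteSelfInjDim_of_injective [Module.Injective S S] : HasFiniteSelfInjDim S := by
  refine ⟨0, fun M i hi ↦ ?_⟩
  obtain ⟨i, rfl⟩ := Nat.exists_eq_succ_of_ne_zero hi.ne'
  have : Injective (ModuleCat.of S S) := Module.injective_object_of_injective_module S S
  exact (isZero_ext_succ_iff _ _ _).2 (Abelian.Ext.subsingleton_of_injective _ _ _)

lemma isGorensteinRing_of_injective [IsNoetherianRing S] [Module.Injective S S] :
    IsGorensteinRing S := by
  intro q hq
  have : Module.Injective (Localization.AtPrime q) (Localization.AtPrime q) :=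
    Module.injective_of_isLocalizedModule q.primeCompl
      (Algebra.linearMap S (Localization.AtPrime q))
  exact hasFiniteSelfInjDim_of_injective

end ExtVanishing

section ArtinianLocal

variable {B : Type} [CommRing B] [IsLocalRing B] [IsArtinianRing B]

variable (B) in
lemma IsArtinianRing.exists_ker_toSpanSingleton_eq_maximalIdeal :
    ∃ s : B, LinearMap.ker (LinearMap.toSpanSingleton B B s) = IsLocalRing.maximalIdeal B := by
  obtain ⟨p, hp⟩ := associatedPrimes.nonempty B B
  obtain ⟨hp, s, hs⟩ := (isAssociatedPrime_iff (I := p) (M := B)).1 hp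
  have hpm : p = IsLocalRing.maximalIdeal B :=
    IsLocalRing.eq_maximalIdeal (IsArtinianRing.isMaximal_of_isPrime p)
  refine ⟨s, ?_⟩
  rw [← hpm, hs]
  ext x
  simp [Submodule.mem_colon_singleton]

lemma subsingleton_ext_of_subsingleton_ext_succ (n : ℕ)
    (h : ∀ (M : Type) [AddCommGroup M] [Module B M] [Module.Finite B M],
      Subsingleton (Abelian.Ext (ModuleCat.of B M) (ModuleCat.of B B) (n + 2)))
    (M : Type) [AddCommGroup M] [Module B M] [Module.Finite B M] :
      Subsingleton (Abelian.Ext (ModuleCat.of B M) (ModuleCat.of B B) (n + 1)) := by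
  refine IsNoetherianRing.induction_on_isQuotientEquivQuotientPrime
    (motive := fun M _ _ _ ↦
      Subsingleton (Abelian.Ext (ModuleCat.of B M) (ModuleCat.of B B) (n + 1)))
    (A := B) (M := M) inferInstance ?_ ?_ ?_
  · intro N _ _ _ _
    have : Projective (ModuleCat.of B N) :=
      (IsProjective.iff_projective N).1 inferInstance
    exact Abelian.Ext.subsingleton_of_projective _ _ _
  · intro N _ _ _ p e
    obtain ⟨s, hs⟩ := IsArtinianRing.exists_ker_toSpanSingleton_eq_maximalIdeal B
    rw [← IsLocalRing.eq_maximalIdeal (IsArtinianRing.isMaximal_of_isPrime p.1)] at hs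
    let f : (B ⧸ p.1) →ₗ[B] B := Submodule.liftQ p.1 (LinearMap.toSpanSingleton B B s) hs.ge
    have hf : Function.Injective f := by
      rw [← LinearMap.ker_eq_bot, Submodule.ker_liftQ_eq_bot _ _ _ hs.le]
    let j : N →ₗ[B] B := f ∘ₗ e.toLinearMap
    have hT := shortExact_of_exact j (LinearMap.range j).mkQ (hf.comp e.injective)
      (Submodule.mkQ_surjective _) (LinearMap.exact_map_mkQ_range j)
    have : Projective (ModuleCat.of B B) := (IsProjective.iff_projective B).1 inferInstance
    have := h (B ⧸ LinearMap.range j)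
    refine subsingleton_of_forall_eq 0 fun x ↦ ?_
    obtain ⟨y, rfl⟩ := Abelian.Ext.contravariant_sequence_exact₁ hT _ x (n₁ := n + 2)
      (by lia) (Subsingleton.elim _ _)
    rw [y.eq_zero_of_projective, Abelian.Ext.comp_zero]
  · intro N₁ _ _ _ N₂ _ _ _ N₃ _ _ _ f g hf hg hfg h₁ h₃
    refine subsingleton_of_forall_eq 0 fun x ↦ ?_
    obtain ⟨y, rfl⟩ := Abelian.Ext.contravariant_sequence_exact₂
      (shortExact_of_exact f g hf hg hfg) _ x (Subsingleton.elim _ _)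
    rw [h₃.elim y 0, Abelian.Ext.comp_zero]

lemma HasFiniteSelfInjDim.subsingleton_ext_one (hB : HasFiniteSelfInjDim B)
    (M : Type) [AddCommGroup M] [Module B M] [Module.Finite B M] :
    Subsingleton (Abelian.Ext (ModuleCat.of B M) (ModuleCat.of B B) 1) := by
  obtain ⟨n, hn⟩ := hB
  have key : ∀ (m : ℕ), (∀ (M : Type) [AddCommGroup M] [Module B M] [Module.Finite B M],
      Subsingleton (Abelian.Ext (ModuleCat.of B M) (ModuleCat.of B B) (m + 1))) →
      ∀ (M : Type) [AddCommGroup M] [Module B M] [Module.Finite B M],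
      Subsingleton (Abelian.Ext (ModuleCat.of B M) (ModuleCat.of B B) 1) := by
    intro m
    induction m with
    | zero => exact fun h ↦ h
    | succ m ih => exact fun h ↦ ih (subsingleton_ext_of_subsingleton_ext_succ m h)
  exact key n (fun M _ _ _ ↦ (isZero_ext_succ_iff _ _ _).1 (hn _ _ n.lt_succ_self)) M

lemma HasFiniteSelfInjDim.mem_span_of_mem_socle (hB : HasFiniteSelfInjDim B) {s t : B}
    (hs0 : s ≠ 0) (ht : ∀ a ∈ IsLocalRing.maximalIdeal B, a * t = 0) : ∃ b, t = b * s := by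
  have hle : LinearMap.ker (LinearMap.toSpanSingleton B B s) ≤
      LinearMap.ker (LinearMap.toSpanSingleton B B t) := by
    intro a ha
    refine ht a (by_contra fun hu ↦ hs0 ?_)
    have hu : IsUnit a := by simpa using hu
    exact (hu.mul_right_eq_zero).1 ha
  let f := LinearMap.toSpanSingleton B B s
  have hsf : s ∈ LinearMap.ker (LinearMap.range f).mkQ := by
    rw [Submodule.ker_mkQ]
    exact ⟨1, by simp [f]⟩
  let u : LinearMap.ker (LinearMap.range f).mkQ →ₗ[B] B :=
    Submodule.liftQ _ (LinearMap.toSpanSingleton B B t) hle ∘ₗ f.quotKerEquivRange.symm ∘ₗ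
      (LinearEquiv.ofEq _ _ (Submodule.ker_mkQ (LinearMap.range f))).toLinearMap
  have hu : u ⟨s, hsf⟩ = t := by
    have : f.quotKerEquivRange.symm ⟨s, by rwa [Submodule.ker_mkQ] at hsf⟩ =
        Submodule.Quotient.mk 1 := by
      rw [LinearEquiv.symm_apply_eq]
      ext
      rw [LinearMap.quotKerEquivRange_apply_mk]
      simp [f]
    change Submodule.liftQ _ (LinearMap.toSpanSingleton B B t) hle
      (f.quotKerEquivRange.symm ⟨s, _⟩) = t
    rw [this, Submodule.liftQ_apply]
    simp
  obtain ⟨v, hv⟩ := exists_extension_of_subsingleton_ext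
    (hB.subsingleton_ext_one (B ⧸ LinearMap.range f)) _ (Submodule.mkQ_surjective _) u
  refine ⟨v 1, ?_⟩
  rw [← hu, ← hv, mul_comm, ← smul_eq_mul, ← map_smul]
  simp

end ArtinianLocal

section Socle

lemma eq_zero_of_algebraMap_localization_eq_zero {A : Type*} [CommRing A] (m : Ideal A)
    [m.IsMaximal] {x : A} (hx : ∀ a ∈ m, a * x = 0)
    (h : algebraMap A (Localization.AtPrime m) x = 0) : x = 0 := by
  obtain ⟨c, hc⟩ := (IsLocalization.map_eq_zero_iff m.primeCompl _ x).1 h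
  obtain ⟨d, hd⟩ := Ideal.IsMaximal.exists_inv ‹m.IsMaximal› c.2
  obtain ⟨i, hi, e⟩ := hd
  linear_combination -x * e + hx i hi + d * hc

lemma IsGorensteinRing.mem_span_of_mem_socle {A : Type} [CommRing A] [IsArtinianRing A]
    (hA : IsGorensteinRing A) (m : Ideal A) [m.IsMaximal] {s t : A} (hs0 : s ≠ 0)
    (hs : ∀ a ∈ m, a * s = 0) (ht : ∀ a ∈ m, a * t = 0) : ∃ b, t = b * s := by
  have key {x : A} (hx : ∀ a ∈ m, a * x = 0) :
      ∀ a ∈ IsLocalRing.maximalIdeal (Localization.AtPrime m),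
        a * algebraMap A (Localization.AtPrime m) x = 0 := by
    suffices IsLocalRing.maximalIdeal (Localization.AtPrime m) ≤ LinearMap.ker
        (LinearMap.toSpanSingleton (Localization.AtPrime m) _ (algebraMap A _ x)) from this
    rw [← Localization.AtPrime.map_eq_maximalIdeal, Ideal.map_le_iff_le_comap]
    intro a ha
    change algebraMap A (Localization.AtPrime m) a * algebraMap A _ x = 0
    rw [← map_mul, hx a ha, map_zero]
  obtain ⟨b, hb⟩ := (hA m inferInstance).mem_span_of_mem_socle
    (fun h ↦ hs0 (eq_zero_of_algebraMap_localization_eq_zero m hs h)) (key ht)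
  obtain ⟨b, rfl⟩ := IsArtinianRing.localization_surjective m.primeCompl _ b
  refine ⟨b, sub_eq_zero.1 (eq_zero_of_algebraMap_localization_eq_zero m (fun a ha ↦ ?_) ?_)⟩
  · linear_combination ht a ha - b * hs a ha
  · rw [map_sub, map_mul, hb, sub_self]

end Socle

section Cyclic

/-- Over a semilocal ring, a finite module whose reductions modulo all maximal ideals are
cyclic is cyclic. -/
lemma exists_span_singleton_eq_top_of_forall_isMaximal {S M : Type*} [CommRing S]
    [Finite (MaximalSpectrum S)] [AddCommGroup M] [Module S M] [Module.Finite S M]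
    (h : ∀ m : Ideal S, m.IsMaximal → ∀ x y : M, x ∉ m • (⊤ : Submodule S M) →
      y ∈ m • (⊤ : Submodule S M) ⊔ Submodule.span S {x}) :
    ∃ x : M, Submodule.span S {x} = ⊤ := by
  classical
  have := Fintype.ofFinite (MaximalSpectrum S)
  have hex (m : MaximalSpectrum S) : ∃ x : M, m.1 • (⊤ : Submodule S M) ≠ ⊤ →
      x ∉ m.1 • (⊤ : Submodule S M) := by
    by_cases hm : m.1 • (⊤ : Submodule S M) = ⊤
    · exact ⟨0, fun h ↦ (h hm).elim⟩
    · obtain ⟨x, -, hx⟩ := SetLike.exists_of_lt (lt_top_iff_ne_top.2 hm)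
      exact ⟨x, fun _ ↦ hx⟩
  choose x hx using hex
  have hcop : Pairwise fun m n : MaximalSpectrum S ↦ IsCoprime m.1 n.1 := fun m n hmn ↦
    Ideal.isCoprime_of_isMaximal fun h ↦ hmn (MaximalSpectrum.ext h)
  have he (m : MaximalSpectrum S) : ∃ e : S, ∀ n : MaximalSpectrum S,
      e - (if n = m then 1 else 0) ∈ n.1 :=
    Ideal.exists_forall_sub_mem_ideal hcop _
  choose e he using he
  refine ⟨∑ m, e m • x m, ?_⟩
  set z := ∑ m, e m • x m with hz
  have hzx (n : MaximalSpectrum S) : z - x n ∈ n.1 • (⊤ : Submodule S M) := by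
    have : z - x n = ∑ m, (e m - if n = m then 1 else 0) • x m := by
      simp [sub_smul, hz]
    rw [this]
    exact Submodule.sum_mem _ fun m _ ↦ Submodule.smul_mem_smul (he m n) trivial
  by_contra hne
  obtain ⟨W, hW, hle⟩ := (eq_top_or_exists_le_coatom _).resolve_left hne
  have hsimple : IsSimpleModule S (M ⧸ W) := isSimpleModule_iff_isCoatom.2 hW
  let n : MaximalSpectrum S := ⟨Module.annihilator S (M ⧸ W), IsSimpleModule.annihilator_isMaximal⟩
  have hnW : n.1 • (⊤ : Submodule S M) ≤ W := by
    rw [Submodule.smul_le]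
    intro a ha y _
    rw [← Submodule.Quotient.mk_eq_zero, Submodule.Quotient.mk_smul]
    exact Module.mem_annihilator.1 ha _
  have hxn := hx n fun htop ↦ hW.1 (top_le_iff.1 (htop ▸ hnW))
  have hzn : z ∉ n.1 • (⊤ : Submodule S M) := fun hz' ↦ hxn <| by
    simpa using Submodule.sub_mem _ hz' (hzx n)
  exact hW.1 (top_le_iff.1 fun y _ ↦ (sup_le hnW hle) (h n.1 n.2 z y hzn))

end Cyclic

section FieldDual

variable {K A : Type} [Field K] [CommRing A] [Algebra K A]

lemma dualModule_smul_apply {k A : Type} [CommRing k] [CommRing A] [Algebra k A] (a : A)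
    (φ : A →ₗ[k] k) (x : A) : (a • φ) x = φ (a * x) :=
  rfl

instance dualModule_isScalarTower (k A : Type) [CommRing k] [CommRing A] [Algebra k A] :
    IsScalarTower k A (A →ₗ[k] k) where
  smul_assoc c a φ := by
    ext x
    simp [dualModule_smul_apply]

variable [Module.Finite K A]

/-- A `K`-subspace of the dual of a finite-dimensional space is cut out by vectors. -/
lemma exists_apply_ne_zero_of_notMem (W : Submodule K (A →ₗ[K] K)) {x : A →ₗ[K] K}
    (hx : x ∉ W) : ∃ t : A, (∀ ψ ∈ W, ψ t = 0) ∧ x t ≠ 0 := by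
  obtain ⟨f, hfx, hf⟩ := Submodule.exists_le_ker_of_notMem hx
  obtain ⟨t, rfl⟩ := (Module.evalEquiv K A).surjective f
  exact ⟨t, fun ψ hψ ↦ hf hψ, hfx⟩

lemma IsGorensteinRing.exists_span_dual_eq_top (hA : IsGorensteinRing A) :
    ∃ Φ : A →ₗ[K] K, Submodule.span A {Φ} = ⊤ := by
  have : IsArtinianRing A := IsArtinianRing.of_finite K A
  have : Module.Finite A (A →ₗ[K] K) := Module.Finite.of_restrictScalars_finite K A _
  refine exists_span_singleton_eq_top_of_forall_isMaximal fun m hm x y hx ↦ ?_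
  have hsocle {t : A} (ht : ∀ ψ ∈ m • (⊤ : Submodule A (A →ₗ[K] K)), ψ t = 0) :
      ∀ a ∈ m, a * t = 0 := fun a ha ↦
    (Module.forall_dual_apply_eq_zero_iff K _).1 fun ψ ↦
      ht _ (Submodule.smul_mem_smul ha (Submodule.mem_top (x := ψ)))
  by_contra hy
  obtain ⟨s, hs, hys⟩ := exists_apply_ne_zero_of_notMem
    ((m • (⊤ : Submodule A (A →ₗ[K] K)) ⊔ Submodule.span A {x}).restrictScalars K) hy
  obtain ⟨t, ht, hxt⟩ := exists_apply_ne_zero_of_notMem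
    ((m • (⊤ : Submodule A (A →ₗ[K] K))).restrictScalars K) hx
  have hs0 : s ≠ 0 := by
    rintro rfl
    simp at hys
  obtain ⟨b, rfl⟩ := hA.mem_span_of_mem_socle m hs0
    (hsocle fun ψ hψ ↦ hs ψ (Submodule.mem_sup_left hψ)) (hsocle ht)
  exact hxt (hs (b • x) (Submodule.mem_sup_right
    (Submodule.smul_mem _ _ (Submodule.mem_span_singleton_self x))))

end FieldDual

section DualBaseChange

variable {P Q K A ι : Type} [CommRing P] [CommRing Q] [CommRing K] [CommRing A]
  [Algebra P Q] [Algebra P K] [Algebra K A]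

/-- The base change map `Hom_P(Q, P) → Hom_K(A, K)` for `A = K ⊗_P Q`, described by a basis
of `A` over `K` induced by a basis of `Q` over `P`. -/
def dualBaseChange (b : Module.Basis ι P Q) (bA : Module.Basis ι K A) :
    (Q →ₗ[P] P) →ₗ[P] (A →ₗ[K] K) where
  toFun φ := bA.constr K fun i ↦ algebraMap P K (φ (b i))
  map_add' φ ψ := bA.ext fun i ↦ by
    simp only [Module.Basis.constr_basis, LinearMap.add_apply, map_add]
  map_smul' c φ := bA.ext fun i ↦ by
    simp only [Module.Basis.constr_basis, LinearMap.smul_apply, smul_eq_mul, map_mul,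
      Algebra.smul_def, RingHom.id_apply]

variable {b : Module.Basis ι P Q} {bA : Module.Basis ι K A}

lemma dualBaseChange_apply_basis (φ : Q →ₗ[P] P) (i : ι) :
    dualBaseChange b bA φ (bA i) = algebraMap P K (φ (b i)) :=
  bA.constr_basis K _ i

lemma dualBaseChange_coord (i : ι) : dualBaseChange b bA (b.coord i) = bA.coord i := by
  classical
  refine bA.ext fun j ↦ ?_
  rw [dualBaseChange_apply_basis]
  simp [Finsupp.single_apply]

lemma eq_zero_of_forall_dualBaseChange_apply {r : A}
    (h : ∀ φ : Q →ₗ[P] P, dualBaseChange b bA φ r = 0) : r = 0 :=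
  bA.ext_elem fun i ↦ by simpa [dualBaseChange_coord] using h (b.coord i)

lemma dualBaseChange_surjective (hK : Function.Surjective (algebraMap P K)) :
    Function.Surjective (dualBaseChange b bA) := by
  intro ψ
  choose f hf using fun i ↦ hK (ψ (bA i))
  refine ⟨b.constr P f, bA.ext fun i ↦ ?_⟩
  rw [dualBaseChange_apply_basis, Module.Basis.constr_basis, hf]

variable [Fintype ι]

lemma dual_eq_sum_coord (φ : Q →ₗ[P] P) : φ = ∑ i, φ (b i) • b.coord i := by
  classical
  refine b.ext fun j ↦ ?_
  simp

lemma mem_smul_top_of_dualBaseChange_eq_zero {I : Ideal P}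
    (hI : ∀ x, algebraMap P K x = 0 → x ∈ I) {φ : Q →ₗ[P] P}
    (h : dualBaseChange b bA φ = 0) : φ ∈ I • (⊤ : Submodule P (Q →ₗ[P] P)) := by
  rw [dual_eq_sum_coord (b := b) φ]
  refine Submodule.sum_mem _ fun i _ ↦ Submodule.smul_mem_smul (hI _ ?_) trivial
  rw [← dualBaseChange_apply_basis (bA := bA), h, LinearMap.zero_apply]

variable [Algebra Q A] [Algebra P A] [IsScalarTower P K A] [IsScalarTower P Q A]

lemma algebraMap_eq_sum_basis (hb : ∀ i, bA i = algebraMap Q A (b i)) (x : Q) :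
    algebraMap Q A x = ∑ i, algebraMap P K (b.repr x i) • bA i := by
  conv_lhs => rw [← b.sum_repr x]
  simp only [map_sum, hb, Algebra.smul_def, map_mul, ← IsScalarTower.algebraMap_apply]

lemma dualBaseChange_apply_algebraMap (hb : ∀ i, bA i = algebraMap Q A (b i)) (φ : Q →ₗ[P] P)
    (x : Q) : dualBaseChange b bA φ (algebraMap Q A x) = algebraMap P K (φ x) := by
  conv_rhs => rw [← b.sum_repr x]
  simp only [algebraMap_eq_sum_basis hb, map_sum, map_smul, dualBaseChange_apply_basis,
    smul_eq_mul, map_mul]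

lemma dualBaseChange_smul (hb : ∀ i, bA i = algebraMap Q A (b i)) (q : Q) (φ : Q →ₗ[P] P) :
    dualBaseChange b bA (q • φ) = algebraMap Q A q • dualBaseChange b bA φ := by
  refine bA.ext fun i ↦ ?_
  rw [dualBaseChange_apply_basis, dualModule_smul_apply, dualModule_smul_apply, hb, ← map_mul,
    dualBaseChange_apply_algebraMap hb]

end DualBaseChange

section Fiber

variable {P Q K A ι : Type} [CommRing P] [CommRing Q] [Field K] [CommRing A]
  [Algebra P Q] [Algebra P K] [Algebra K A] [Algebra Q A] [Algebra P A]
  [IsScalarTower P K A] [IsScalarTower P Q A] [Fintype ι]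
  {b : Module.Basis ι P Q} {bA : Module.Basis ι K A}

lemma exists_common_denominator (q : Ideal P) [q.IsPrime] [Algebra (P ⧸ q) K]
    [IsScalarTower P (P ⧸ q) K] [IsFractionRing (P ⧸ q) K] (f : ι → K) :
    ∃ s ∉ q, ∃ g : ι → P, ∀ i, algebraMap P K s * f i = algebraMap P K (g i) := by
  obtain ⟨⟨s, hs⟩, h⟩ :=
    IsLocalization.exist_integer_multiples_of_finite (nonZeroDivisors (P ⧸ q)) f
  obtain ⟨s, rfl⟩ := Ideal.Quotient.mk_surjective s
  choose g hg using h
  choose g' hg' using fun i ↦ Ideal.Quotient.mk_surjective (g i)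
  refine ⟨s, fun h ↦ nonZeroDivisors.ne_zero hs (Ideal.Quotient.eq_zero_iff_mem.2 h), g',
    fun i ↦ ?_⟩
  have := hg i
  rw [← hg' i, Algebra.smul_def] at this
  simp only [← Ideal.Quotient.algebraMap_eq, ← IsScalarTower.algebraMap_apply] at this
  exact this.symm

lemma exists_generator_up_to_denominators (hb : ∀ i, bA i = algebraMap Q A (b i))
    (q : Ideal P) [q.IsPrime] [Algebra (P ⧸ q) K]
    [IsScalarTower P (P ⧸ q) K] [IsFractionRing (P ⧸ q) K] {Φ : A →ₗ[K] K}
    (hΦ : Submodule.span A {Φ} = ⊤) :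
    ∃ φ : Q →ₗ[P] P, ∀ x : Q →ₗ[P] P, ∃ s ∉ q, ∃ α : Q,
      s • x - α • φ ∈ q • (⊤ : Submodule P (Q →ₗ[P] P)) := by
  obtain ⟨s₀, hs₀, g₀, hg₀⟩ := exists_common_denominator q fun i ↦ Φ (bA i)
  have hφ : dualBaseChange b bA (b.constr P g₀) = algebraMap P A s₀ • Φ := by
    refine bA.ext fun i ↦ ?_
    rw [dualBaseChange_apply_basis, Module.Basis.constr_basis, ← hg₀, dualModule_smul_apply,
      IsScalarTower.algebraMap_apply P K A, ← Algebra.smul_def (algebraMap P K s₀) (bA i),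
      map_smul, smul_eq_mul]
  refine ⟨b.constr P g₀, fun x ↦ ?_⟩
  obtain ⟨a, ha⟩ := Submodule.mem_span_singleton.1
    (hΦ ▸ Submodule.mem_top : dualBaseChange b bA x ∈ Submodule.span A {Φ})
  obtain ⟨s, hs, g, hg⟩ := exists_common_denominator q (bA.repr a)
  have hα : algebraMap Q A (∑ i, g i • b i) = algebraMap P A s * a := by
    rw [algebraMap_eq_sum_basis hb, IsScalarTower.algebraMap_apply P K A, ← Algebra.smul_def]
    conv_rhs => rw [← bA.sum_repr a]
    rw [Finset.smul_sum]
    refine Finset.sum_congr rfl fun i _ ↦ ?_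
    rw [smul_smul, hg i, b.repr_sum_self]
  refine ⟨s * s₀, Ideal.IsPrime.mul_notMem ‹_› hs hs₀, ∑ i, g i • b i,
    mem_smul_top_of_dualBaseChange_eq_zero (b := b) (bA := bA) (fun y hy ↦ ?_) ?_⟩
  · rwa [IsScalarTower.algebraMap_apply P (P ⧸ q) K, IsFractionRing.to_map_eq_zero_iff,
      Ideal.Quotient.algebraMap_eq, Ideal.Quotient.eq_zero_iff_mem] at hy
  · rw [map_sub, dualBaseChange_smul hb, hα, hφ, ← algebraMap_smul Q, dualBaseChange_smul hb,
      ← ha, ← IsScalarTower.algebraMap_apply, smul_smul, smul_smul, map_mul, sub_eq_zero]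
    congr 1
    ring

/-- A balanced form on `Hom_P(Q, P)` is symmetric modulo `q` if `Hom_P(Q, P)` is cyclic over
`Q` at the residue field of `q`. -/
lemma apply_tmul_sub_apply_tmul_mem (q : Ideal P) [q.IsPrime] {φ : Q →ₗ[P] P}
    (hφ : ∀ x : Q →ₗ[P] P, ∃ s ∉ q, ∃ α : Q,
      s • x - α • φ ∈ q • (⊤ : Submodule P (Q →ₗ[P] P)))
    (c : (Q →ₗ[P] P) ⊗[Q] (Q →ₗ[P] P) →ₗ[P] P) (x y : Q →ₗ[P] P) :
    c (x ⊗ₜ y) - c (y ⊗ₜ x) ∈ q := by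
  have hl {w : Q →ₗ[P] P} (hw : w ∈ q • (⊤ : Submodule P (Q →ₗ[P] P))) (z : Q →ₗ[P] P) :
      c (w ⊗ₜ z) ∈ q := by
    induction hw using Submodule.smul_induction_on' with
    | smul r hr w _ =>
      rw [← TensorProduct.smul_tmul', map_smul]
      exact q.mul_mem_right _ hr
    | add u _ v _ hu hv =>
      rw [TensorProduct.add_tmul, map_add]
      exact q.add_mem hu hv
  have hr {w : Q →ₗ[P] P} (hw : w ∈ q • (⊤ : Submodule P (Q →ₗ[P] P))) (z : Q →ₗ[P] P) :
      c (z ⊗ₜ w) ∈ q := by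
    induction hw using Submodule.smul_induction_on' with
    | smul r hr w _ =>
      rw [TensorProduct.tmul_smul, map_smul]
      exact q.mul_mem_right _ hr
    | add u _ v _ hu hv =>
      rw [TensorProduct.tmul_add, map_add]
      exact q.add_mem hu hv
  obtain ⟨s, hs, α, hx⟩ := hφ x
  obtain ⟨t, ht, β, hy⟩ := hφ y
  have hsymm : (α • φ) ⊗ₜ[Q] (β • φ) = (β • φ) ⊗ₜ[Q] (α • φ) := by
    simp only [TensorProduct.smul_tmul_smul, mul_comm]
  have key : (s * t) * (c (x ⊗ₜ y) - c (y ⊗ₜ x)) =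
      c ((s • x - α • φ) ⊗ₜ (t • y)) + c ((α • φ) ⊗ₜ (t • y - β • φ))
        - (c ((t • y - β • φ) ⊗ₜ (s • x)) + c ((β • φ) ⊗ₜ (s • x - α • φ))) := by
    simp only [TensorProduct.sub_tmul, TensorProduct.tmul_sub, map_sub, hsymm]
    simp only [← TensorProduct.smul_tmul', TensorProduct.tmul_smul, map_smul, smul_eq_mul]
    ring
  refine ((Ideal.IsPrime.mem_or_mem ‹q.IsPrime› (key ▸ ?_ : _ ∈ q))).resolve_left
    (Ideal.IsPrime.mul_notMem ‹_› hs ht)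
  exact q.sub_mem (q.add_mem (hl hx _) (hr hy _)) (q.add_mem (hl hy _) (hr hx _))

end Fiber

section ClosedFiber

variable {P Q k R ι : Type} [CommRing P] [CommRing Q] [CommRing k] [CommRing R]
  [Algebra P Q] [Algebra P k] [Algebra k R] [Algebra Q R] [Algebra P R]
  [IsScalarTower P k R] [IsScalarTower P Q R] [Fintype ι]
  {b : Module.Basis ι P Q} {bR : Module.Basis ι k R}

lemma algebraMap_surjective_of_basis (hb : ∀ i, bR i = algebraMap Q R (b i))
    (hk : Function.Surjective (algebraMap P k)) : Function.Surjective (algebraMap Q R) := by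
  intro r
  choose f hf using fun i ↦ hk (bR.repr r i)
  refine ⟨∑ i, f i • b i, ?_⟩
  rw [algebraMap_eq_sum_basis hb]
  simp only [b.repr_sum_self, hf, bR.sum_repr]

lemma mem_smul_top_of_algebraMap_eq_zero (hb : ∀ i, bR i = algebraMap Q R (b i)) {I : Ideal P}
    (hI : ∀ x, algebraMap P k x = 0 ↔ x ∈ I) {x : Q} (hx : algebraMap Q R x = 0) :
    x ∈ I • (⊤ : Submodule P Q) := by
  rw [← b.sum_repr x]
  refine Submodule.sum_mem _ fun i _ ↦ Submodule.smul_mem_smul ((hI _).1 ?_) trivial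
  have : bR.repr (algebraMap Q R x) i = 0 := by rw [hx, map_zero, Finsupp.zero_apply]
  rwa [algebraMap_eq_sum_basis hb, bR.repr_sum_self] at this

lemma mem_smul_top_of_forall_algebraMap_eq_zero {κ : Type} [Finite κ]
    (hb : ∀ i, bR i = algebraMap Q R (b i)) {I : Ideal P}
    (hI : ∀ x, algebraMap P k x = 0 ↔ x ∈ I) {w : κ → Q} (hw : ∀ j, algebraMap Q R (w j) = 0) :
    w ∈ I • (⊤ : Submodule P (κ → Q)) := by
  classical
  cases nonempty_fintype κ
  rw [← Finset.univ_sum_single w]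
  refine Submodule.sum_mem _ fun j _ ↦ ?_
  have := Submodule.mem_map_of_mem (f := LinearMap.single P (fun _ : κ ↦ Q) j)
    (mem_smul_top_of_algebraMap_eq_zero hb hI (hw j))
  rw [Submodule.map_smul''] at this
  exact Submodule.smul_mono le_rfl le_top this

lemma map_eq_zero_of_mem_smul_top {I : Ideal P} (hI : ∀ x, algebraMap P k x = 0 ↔ x ∈ I)
    {M : Type} [AddCommGroup M] [Module P M] (f : M →ₗ[P] R) {m : M}
    (hm : m ∈ I • (⊤ : Submodule P M)) : f m = 0 := by
  induction hm using Submodule.smul_induction_on' with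
  | smul r hr m _ =>
    rw [map_smul, ← algebraMap_smul R r, IsScalarTower.algebraMap_apply P k R, (hI r).2 hr,
      map_zero, zero_smul]
  | add x _ y _ hx hy => rw [map_add, hx, hy, add_zero]

/-- If `Ext^1_R(Hom_k(R, k), R) = 0` then also `Ext^1_Q(Hom_P(Q, P), R) = 0`. -/
lemma exists_extension_of_subsingleton_ext_dual {κ : Type} [Finite κ]
    (hb : ∀ i, bR i = algebraMap Q R (b i)) {I : Ideal P}
    (hk : Function.Surjective (algebraMap P k)) (hI : ∀ x, algebraMap P k x = 0 ↔ x ∈ I)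
    (h : Subsingleton (Abelian.Ext (ModuleCat.of R (R →ₗ[k] k)) (ModuleCat.of R R) 1))
    (π : (κ → Q) →ₗ[Q] (Q →ₗ[P] P)) (hπ : Function.Surjective π)
    (u : LinearMap.ker π →ₗ[Q] R) :
    ∃ v : (κ → Q) →ₗ[Q] R, v ∘ₗ (LinearMap.ker π).subtype = u := by
  classical
  cases nonempty_fintype κ
  have hR := algebraMap_surjective_of_basis hb hk
  let c : (κ → Q) →ₗ[Q] (κ → R) := (Algebra.linearMap Q R).compLeft κ
  have hc (w j) : c w j = algebraMap Q R (w j) := rfl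
  have hcsurj (y) : ∃ w, c w = y := by
    choose f hf using fun j ↦ hR (y j)
    exact ⟨f, funext hf⟩
  have hc0 {w} (hw : w ∈ I • (⊤ : Submodule P (κ → Q))) : c w = 0 :=
    funext fun j ↦ map_eq_zero_of_mem_smul_top hI (LinearMap.proj j ∘ₗ c.restrictScalars P) hw
  let π' : (κ → R) →ₗ[R] (R →ₗ[k] k) :=
    Fintype.linearCombination R fun j ↦ dualBaseChange b bR (π (Pi.single j 1))
  have hπ' (w) : π' (c w) = dualBaseChange b bR (π w) := by
    rw [LinearMap.pi_apply_eq_sum_univ π w, map_sum, Fintype.linearCombination_apply]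
    refine Finset.sum_congr rfl fun j _ ↦ ?_
    rw [dualBaseChange_smul hb, hc]
    congr
    ext i
    simp [Pi.single_apply, eq_comm]
  have hsurj : Function.Surjective π' := by
    intro ψ
    obtain ⟨φ, rfl⟩ := dualBaseChange_surjective (b := b) (bA := bR) hk ψ
    obtain ⟨w, rfl⟩ := hπ φ
    exact ⟨c w, hπ' w⟩
  have hlift (y : LinearMap.ker π') : ∃ z : LinearMap.ker π, c z = y := by
    obtain ⟨w, hw⟩ := hcsurj y
    have h0 : dualBaseChange b bR (π w) = 0 := by rw [← hπ', hw]; exact y.2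
    have h1 := mem_smul_top_of_dualBaseChange_eq_zero (fun x hx ↦ (hI x).1 hx) h0
    rw [← LinearMap.range_eq_top.2 (show Function.Surjective (π.restrictScalars P) from hπ),
      LinearMap.range_eq_map, ← Submodule.map_smul''] at h1
    obtain ⟨w', hw', hww'⟩ := h1
    refine ⟨⟨w - w', ?_⟩, ?_⟩
    · rw [LinearMap.mem_ker, map_sub, sub_eq_zero]
      exact hww'.symm
    · rw [map_sub, hw, hc0 hw', sub_zero]
  have : Module.Free P Q := .of_basis b
  have : Module.Finite P Q := .of_basis b
  obtain ⟨σ, hσ⟩ := Module.projective_lifting_property (π.restrictScalars P) LinearMap.id hπ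
  replace hσ (φ) : π (σ φ) = φ := LinearMap.congr_fun hσ φ
  let g : (κ → Q) →ₗ[P] R := u.restrictScalars P ∘ₗ
    (LinearMap.id - σ ∘ₗ π.restrictScalars P).codRestrict ((LinearMap.ker π).restrictScalars P)
      fun w ↦ by simp [hσ]
  have hg (z : LinearMap.ker π) : g z = u z := by
    refine congrArg u (Subtype.ext ?_)
    change (z : κ → Q) - σ (π z) = z
    rw [LinearMap.mem_ker.1 z.2, map_zero, sub_zero]
  have hzero (z : LinearMap.ker π) (hz : c z = 0) : u z = 0 := by
    rw [← hg]
    exact map_eq_zero_of_mem_smul_top hI g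
      (mem_smul_top_of_forall_algebraMap_eq_zero hb hI fun j ↦ congrFun hz j)
  choose s hs using hlift
  let u' : LinearMap.ker π' →ₗ[R] R :=
    { toFun := fun y ↦ u (s y)
      map_add' := fun y y' ↦ by
        rw [← map_add, ← sub_eq_zero, ← map_sub]
        refine hzero _ ?_
        simp [hs]
      map_smul' := fun r y ↦ by
        obtain ⟨q, rfl⟩ := hR r
        rw [RingHom.id_apply, algebraMap_smul, algebraMap_smul, ← map_smul, ← sub_eq_zero, ← map_sub]
        refine hzero _ ?_
        simp [hs] }
  obtain ⟨v, hv⟩ := exists_extension_of_subsingleton_ext h π' hsurj u'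
  refine ⟨v.restrictScalars Q ∘ₗ c, LinearMap.ext fun z ↦ ?_⟩
  have hz : c z ∈ LinearMap.ker π' := by
    rw [LinearMap.mem_ker, hπ', LinearMap.mem_ker.1 z.2, map_zero]
  have h1 : v (c z) = u (s ⟨c z, hz⟩) := LinearMap.congr_fun hv ⟨c z, hz⟩
  change v (c z) = u z
  rw [h1, ← sub_eq_zero, ← map_sub]
  refine hzero _ ?_
  simp [hs]

end ClosedFiber

section TensorFree

lemma IsLocalRing.lTensor_residueField_injective_of_forall_exists {P N L : Type} [CommRing P]
    [IsLocalRing P] [AddCommGroup N] [Module P N] [AddCommGroup L] [Module P L] (f : N →ₗ[P] L)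
    (h : ∀ l : N →ₗ[P] IsLocalRing.ResidueField P,
      ∃ l' : L →ₗ[P] IsLocalRing.ResidueField P, l' ∘ₗ f = l) :
    Function.Injective (f.lTensor (IsLocalRing.ResidueField P)) := by
  rw [injective_iff_map_eq_zero]
  intro t ht
  rw [← Module.forall_dual_apply_eq_zero_iff (IsLocalRing.ResidueField P)]
  intro l
  obtain ⟨l', hl'⟩ := h (l.restrictScalars P ∘ₗ
    TensorProduct.mk P (IsLocalRing.ResidueField P) N 1)
  have key : l.restrictScalars P = LinearMap.mul' P (IsLocalRing.ResidueField P) ∘ₗ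
      l'.lTensor _ ∘ₗ f.lTensor _ := by
    refine TensorProduct.ext' fun a n ↦ ?_
    have : l' (f n) = l (1 ⊗ₜ n) := LinearMap.congr_fun hl' n
    simp only [LinearMap.coe_comp, Function.comp_apply, LinearMap.lTensor_tmul, this,
      LinearMap.mul'_apply, LinearMap.restrictScalars_apply]
    rw [← smul_eq_mul, ← map_smul, TensorProduct.smul_tmul', smul_eq_mul, mul_one]
  have := LinearMap.congr_fun key t
  simpa [ht] using this

section

variable {P Q k R ι : Type} [CommRing P] [CommRing Q] [CommRing k] [CommRing R]
  [Algebra P Q] [Algebra P k] [Algebra k R] [Algebra Q R] [Algebra P R]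
  [IsScalarTower P k R] [IsScalarTower P Q R] [Fintype ι]
  {b : Module.Basis ι P Q} {bR : Module.Basis ι k R}

/-- Functionals on `M ⊗_Q Hom_P(Q, P)` with values in `k` correspond to `Q`-linear maps `M → R`. -/
lemma exists_dualBaseChange_apply_eq {M : Type} [AddCommGroup M] [Module Q M] [Module P M]
    [IsScalarTower P Q M] (hb : ∀ i, bR i = algebraMap Q R (b i))
    (l : M ⊗[Q] (Q →ₗ[P] P) →ₗ[P] k) :
    ∃ u : M →ₗ[Q] R, ∀ m φ, dualBaseChange b bR φ (u m) = l (m ⊗ₜ φ) := by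
  let u (m : M) : R := ∑ i, l (m ⊗ₜ b.coord i) • bR i
  have hu (m φ) : dualBaseChange b bR φ (u m) = l (m ⊗ₜ φ) := by
    conv_rhs => rw [dual_eq_sum_coord (b := b) φ]
    simp only [u, map_sum, map_smul, dualBaseChange_apply_basis, TensorProduct.tmul_sum,
      TensorProduct.tmul_smul, smul_eq_mul]
    simp only [Algebra.smul_def, mul_comm]
  refine ⟨{ toFun := u, map_add' := fun m m' ↦ ?_, map_smul' := fun q m ↦ ?_ }, hu⟩
  · rw [← sub_eq_zero]
    refine eq_zero_of_forall_dualBaseChange_apply (b := b) (bA := bR) fun φ ↦ ?_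
    simp only [map_sub, map_add, hu, TensorProduct.add_tmul, sub_self]
  · rw [← sub_eq_zero]
    refine eq_zero_of_forall_dualBaseChange_apply (b := b) (bA := bR) fun φ ↦ ?_
    rw [map_sub, hu, TensorProduct.smul_tmul, ← hu, dualBaseChange_smul hb,
      dualModule_smul_apply, RingHom.id_apply, Algebra.smul_def, sub_self]

lemma exists_functional_tmul_eq {M : Type} [AddCommGroup M] [Module Q M] [Module P M]
    [IsScalarTower P Q M] (hb : ∀ i, bR i = algebraMap Q R (b i)) (v : M →ₗ[Q] R) :
    ∃ l : M ⊗[Q] (Q →ₗ[P] P) →ₗ[P] k, ∀ m φ, l (m ⊗ₜ φ) = dualBaseChange b bR φ (v m) := by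
  let f : M →+ (Q →ₗ[P] P) →+ k := AddMonoidHom.mk' (fun m ↦ AddMonoidHom.mk'
    (fun φ ↦ dualBaseChange b bR φ (v m)) fun φ ψ ↦ by rw [map_add, LinearMap.add_apply])
    fun m m' ↦ by ext φ; simp
  let l := TensorProduct.liftAddHom (R := Q) f fun q m φ ↦ by
    change dualBaseChange b bR φ (v (q • m)) = dualBaseChange b bR (q • φ) (v m)
    rw [dualBaseChange_smul hb, dualModule_smul_apply, map_smul, Algebra.smul_def]
  have hl (m φ) : l (m ⊗ₜ φ) = dualBaseChange b bR φ (v m) := rfl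
  refine ⟨{ l with map_smul' := fun r t ↦ ?_ }, hl⟩
  change l (r • t) = r • l t
  induction t with
  | zero => simp
  | add x y hx hy => rw [smul_add, map_add, map_add, hx, hy, smul_add]
  | tmul m φ => rw [← TensorProduct.tmul_smul, hl, hl, map_smul, LinearMap.smul_apply]

lemma exists_functional_extension {κ : Type} [Finite κ]
    (hb : ∀ i, bR i = algebraMap Q R (b i)) {I : Ideal P}
    (hk : Function.Surjective (algebraMap P k)) (hI : ∀ x, algebraMap P k x = 0 ↔ x ∈ I)
    (h : Subsingleton (Abelian.Ext (ModuleCat.of R (R →ₗ[k] k)) (ModuleCat.of R R) 1))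
    (π : (κ → Q) →ₗ[Q] (Q →ₗ[P] P)) (hπ : Function.Surjective π)
    (l : LinearMap.ker π ⊗[Q] (Q →ₗ[P] P) →ₗ[P] k) :
    ∃ l' : (κ → Q) ⊗[Q] (Q →ₗ[P] P) →ₗ[P] k,
      l' ∘ₗ ((LinearMap.ker π).subtype.rTensor (Q →ₗ[P] P)).restrictScalars P = l := by
  obtain ⟨u, hu⟩ := exists_dualBaseChange_apply_eq hb l
  obtain ⟨v, hv⟩ := exists_extension_of_subsingleton_ext_dual hb hk hI h π hπ u
  obtain ⟨l', hl'⟩ := exists_functional_tmul_eq hb v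
  refine ⟨l', LinearMap.ext fun t ↦ ?_⟩
  induction t with
  | zero => simp
  | add x y hx hy => rw [map_add, map_add, hx, hy]
  | tmul m φ =>
    rw [← hu, ← hv]
    exact hl' m φ

end

lemma free_tensor_of_forall_exists {P Q N F D E : Type} [CommRing P] [IsLocalRing P] [CommRing Q]
    [Algebra P Q] [AddCommGroup N] [Module Q N] [Module P N] [IsScalarTower P Q N]
    [AddCommGroup F] [Module Q F] [Module P F] [IsScalarTower P Q F]
    [AddCommGroup D] [Module Q D] [Module P D] [IsScalarTower P Q D]
    [AddCommGroup E] [Module Q E] (f : N →ₗ[Q] F) (g : F →ₗ[Q] D) (hfg : Function.Exact f g)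
    (hg : Function.Surjective g) [Module.Finite P (N ⊗[Q] E)] [Module.Finite P (F ⊗[Q] E)]
    [Module.Free P (F ⊗[Q] E)]
    (h : ∀ l : N ⊗[Q] E →ₗ[P] IsLocalRing.ResidueField P,
      ∃ l' : F ⊗[Q] E →ₗ[P] IsLocalRing.ResidueField P,
        l' ∘ₗ (f.rTensor E).restrictScalars P = l) :
    Module.Free P (D ⊗[Q] E) := 
  Module.free_of_lTensor_residueField_injective ((f.rTensor E).restrictScalars P)
    ((g.rTensor E).restrictScalars P) (LinearMap.rTensor_surjective _ hg)
    (rTensor_exact E hfg hg)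
    (IsLocalRing.lTensor_residueField_injective_of_forall_exists _ h)

variable {P Q R ι : Type} [CommRing P] [IsNoetherianRing P] [IsLocalRing P] [CommRing Q]
  [CommRing R] [Algebra P Q] [Algebra (IsLocalRing.ResidueField P) R] [Algebra Q R]
  [Algebra P R] [IsScalarTower P (IsLocalRing.ResidueField P) R] [IsScalarTower P Q R]
  [Fintype ι] {b : Module.Basis ι P Q} {bR : Module.Basis ι (IsLocalRing.ResidueField P) R}

lemma free_dual_tensor_dual (hb : ∀ i, bR i = algebraMap Q R (b i))
    (h : Subsingleton (Abelian.Ext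
      (ModuleCat.of R (R →ₗ[IsLocalRing.ResidueField P] IsLocalRing.ResidueField P))
      (ModuleCat.of R R) 1)) :
    Module.Free P ((Q →ₗ[P] P) ⊗[Q] (Q →ₗ[P] P)) := by
  have : Module.Free P Q := .of_basis b
  have : Module.Finite P Q := .of_basis b
  have : IsNoetherianRing Q := .of_finite P Q
  have : Module.Finite Q (Q →ₗ[P] P) := .of_restrictScalars_finite P Q _
  obtain ⟨n, π, hπ⟩ := Module.Finite.exists_fin' Q (Q →ₗ[P] P)
  let e : (Fin n → Q) ⊗[Q] (Q →ₗ[P] P) ≃ₗ[P] (Fin n → Q →ₗ[P] P) :=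
    (TensorProduct.comm Q _ _ ≪≫ₗ TensorProduct.piScalarRight Q Q _ _).restrictScalars P
  have : Module.Free P ((Fin n → Q) ⊗[Q] (Q →ₗ[P] P)) := .of_equiv e.symm
  have : Module.Finite P ((Fin n → Q) ⊗[Q] (Q →ₗ[P] P)) := .equiv e.symm
  have : Module.Finite P (LinearMap.ker π ⊗[Q] (Q →ₗ[P] P)) := .trans Q _
  exact free_tensor_of_forall_exists (LinearMap.ker π).subtype π
    (LinearMap.exact_subtype_ker_map π) hπ (exists_functional_extension hb
      IsLocalRing.residue_surjective IsLocalRing.residue_eq_zero_iff h π hπ)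

end TensorFree

lemma mem_smul_top_of_forall_apply_mem {P T : Type} [CommRing P] [AddCommGroup T] [Module P T]
    [Module.Free P T] {I : Ideal P} {t : T} (h : ∀ c : T →ₗ[P] P, c t ∈ I) :
    t ∈ I • (⊤ : Submodule P T) := by
  let b := Module.Free.chooseBasis P T
  rw [← b.linearCombination_repr t, Finsupp.linearCombination_apply]
  exact Submodule.sum_mem _ fun i _ ↦ Submodule.smul_mem_smul (h (b.coord i)) trivial

/-- A module whose tensor square is symmetric modulo `I` is locally cyclic over `I`. -/
lemma mem_sup_span_singleton_of_tmul_symm {P Q M : Type} [CommRing P] [CommRing Q] [Algebra P Q]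
    [AddCommGroup M] [Module Q M] [Module P M] [IsScalarTower P Q M] {I : Ideal P}
    (hM : ∀ x y : M, x ⊗ₜ[Q] y - y ⊗ₜ[Q] x ∈ I • (⊤ : Submodule P (M ⊗[Q] M)))
    (m : Ideal Q) [hm : m.IsMaximal] (hIm : I.map (algebraMap P Q) ≤ m) {x : M}
    (hx : x ∉ m • (⊤ : Submodule Q M)) (y : M) :
    y ∈ m • (⊤ : Submodule Q M) ⊔ Submodule.span Q {x} := by
  let := Ideal.Quotient.field m
  let mk := (m • (⊤ : Submodule Q M)).mkQ
  have hmk (z : M) : mk z = 0 ↔ z ∈ m • (⊤ : Submodule Q M) := Submodule.Quotient.mk_eq_zero _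
  have : ∃ l : Module.Dual (Q ⧸ m) (M ⧸ m • (⊤ : Submodule Q M)), l (mk x) ≠ 0 := by
    by_contra! h
    exact hx ((hmk x).1 ((Module.forall_dual_apply_eq_zero_iff (Q ⧸ m) _).1 h))
  obtain ⟨l, hl⟩ := this
  let β : M ⊗[Q] M →ₗ[Q] M ⧸ m • (⊤ : Submodule Q M) := TensorProduct.lift
    (LinearMap.mk₂ Q (fun a c ↦ l (mk a) • mk c)
      (fun a a' c ↦ by simp only [map_add, add_smul])
      (fun r a c ↦ by
        rw [map_smul, ← LinearMap.restrictScalars_apply Q l, map_smul, smul_assoc]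
        rfl)
      (fun a c c' ↦ by simp only [map_add, smul_add])
      (fun r a c ↦ by rw [map_smul, smul_comm]))
  have hβ (a c) : β (a ⊗ₜ c) = l (mk a) • mk c := rfl
  have h0 {t : M ⊗[Q] M} (ht : t ∈ I • (⊤ : Submodule P (M ⊗[Q] M))) : β t = 0 := by
    induction ht using Submodule.smul_induction_on' with
    | smul r hr t _ =>
      obtain ⟨z, hz⟩ := Submodule.mkQ_surjective _ (β t)
      rw [← algebraMap_smul Q r, map_smul, ← hz, ← map_smul]
      exact (hmk _).2 (Submodule.smul_mem_smul (hIm (Ideal.mem_map_of_mem _ hr)) trivial)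
    | add s _ t _ hs ht => rw [map_add, hs, ht, add_zero]
  have key := h0 (hM x y)
  rw [map_sub, hβ, hβ, sub_eq_zero] at key
  obtain ⟨c, hc⟩ := Ideal.Quotient.mk_surjective ((l (mk x))⁻¹ * l (mk y))
  have : mk (y - c • x) = 0 := by
    rw [map_sub, map_smul, sub_eq_zero, ← algebraMap_smul (Q ⧸ m) c, Ideal.Quotient.algebraMap_eq,
      hc, mul_smul, ← key, smul_smul, inv_mul_cancel₀ hl, one_smul]
  rw [← sub_add_cancel y (c • x)]
  exact Submodule.add_mem_sup ((hmk _).1 this)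
    (Submodule.smul_mem _ _ (Submodule.mem_span_singleton_self x))

lemma bijective_of_span_dual_eq_top {P Q : Type} [CommRing P] [CommRing Q] [Algebra P Q]
    [Module.Finite P Q] [Module.Free P Q] {φ : Q →ₗ[P] P} (hφ : Submodule.span Q {φ} = ⊤) :
    Function.Bijective fun x : Q ↦ φ ∘ₗ LinearMap.mulLeft P x := by
  let f : Q →ₗ[P] (Q →ₗ[P] P) := (LinearMap.toSpanSingleton Q (Q →ₗ[P] P) φ).restrictScalars P
  have hf : Function.Surjective f := by
    intro ψ
    exact Submodule.mem_span_singleton.1 (hφ ▸ Submodule.mem_top : ψ ∈ Submodule.span Q {φ})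
  let e : Q ≃ₗ[P] (Q →ₗ[P] P) := (Module.Free.chooseBasis P Q).toDualEquiv
  exact OrzechProperty.bijective_of_surjective_of_injective e.toLinearMap f e.injective hf

lemma injective_self_of_span_dual_eq_top {k R : Type} [Field k] [CommRing R] [Algebra k R]
    {φ : R →ₗ[k] k} (hφ : Submodule.span R {φ} = ⊤) : Module.Injective R R := by
  rw [← Module.Baer.iff_injective]
  intro I u
  have hspan (ψ : R →ₗ[k] k) : ∃ r : R, r • φ = ψ :=
    Submodule.mem_span_singleton.1 (hφ ▸ Submodule.mem_top)
  obtain ⟨ψ, hψ⟩ := LinearMap.exists_extend (p := I.restrictScalars k)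
    (φ ∘ₗ u.restrictScalars k)
  obtain ⟨r, rfl⟩ := hspan ψ
  refine ⟨LinearMap.mulLeft R r, fun x hx ↦ ?_⟩
  rw [← sub_eq_zero]
  refine (Module.forall_dual_apply_eq_zero_iff k _).1 fun χ ↦ ?_
  obtain ⟨s, rfl⟩ := hspan χ
  have h1 : φ (r * (s * x)) = φ (u ⟨s * x, I.mul_mem_left s hx⟩) :=
    LinearMap.congr_fun hψ ⟨s * x, I.mul_mem_left s hx⟩
  have h2 : u ⟨s * x, I.mul_mem_left s hx⟩ = s * u ⟨x, hx⟩ := map_smul u s ⟨x, hx⟩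
  rw [h2] at h1
  rw [dualModule_smul_apply, LinearMap.mulLeft_apply, mul_sub, map_sub, sub_eq_zero, ← h1]
  congr 1
  ring

lemma exists_generator_up_to_denominators_of_isGorensteinRing {P Q : Type} [CommRing P]
    [CommRing Q] [Algebra P Q] [Module.Finite P Q] [Module.Free P Q] (q : Ideal P) [q.IsPrime]
    (hq : IsGorensteinRing (q.ResidueField ⊗[P] Q)) :
    ∃ φ : Q →ₗ[P] P, ∀ x : Q →ₗ[P] P, ∃ s ∉ q, ∃ α : Q,
      s • x - α • φ ∈ q • (⊤ : Submodule P (Q →ₗ[P] P)) := by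
  let : Algebra Q (q.ResidueField ⊗[P] Q) := Algebra.TensorProduct.rightAlgebra
  let b := Module.Free.chooseBasis P Q
  obtain ⟨Φ, hΦ⟩ := hq.exists_span_dual_eq_top (K := q.ResidueField)
  exact exists_generator_up_to_denominators (b := b)
    (bA := Algebra.TensorProduct.basis q.ResidueField b)
    (fun i ↦ Algebra.TensorProduct.basis_apply _ _) q hΦ

lemma finite_maximalSpectrum_of_isLocalRing (P Q : Type) [CommRing P] [IsLocalRing P]
    [CommRing Q] [Algebra P Q] [Module.Finite P Q] : Finite (MaximalSpectrum Q) := by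
  have := (Algebra.QuasiFinite.finite_primesOver (S := Q)
    (IsLocalRing.maximalIdeal P)).to_subtype
  refine Finite.of_injective (β := (IsLocalRing.maximalIdeal P).primesOver Q)
    (fun m ↦ ⟨m.asIdeal, m.isMaximal.isPrime, ⟨?_⟩⟩)
    fun m m' h ↦ MaximalSpectrum.ext (congrArg Subtype.val h)
  have := m.isMaximal
  have := Ideal.isMaximal_comap_of_isIntegral_of_isMaximal (R := P) m.asIdeal
  exact (IsLocalRing.eq_maximalIdeal this).symm

section Main

variable {P Q R ι : Type} [CommRing P] [IsLocalRing P] [CommRing Q]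
  [CommRing R] [Algebra P Q] [Algebra (IsLocalRing.ResidueField P) R] [Algebra Q R]
  [Algebra P R] [IsScalarTower P (IsLocalRing.ResidueField P) R] [IsScalarTower P Q R]
  [Fintype ι] {b : Module.Basis ι P Q} {bR : Module.Basis ι (IsLocalRing.ResidueField P) R}

lemma exists_span_dual_eq_top_of_subsingleton_ext [IsNoetherianRing P]
    (hb : ∀ i, bR i = algebraMap Q R (b i))
    (h : Subsingleton (Abelian.Ext
      (ModuleCat.of R (R →ₗ[IsLocalRing.ResidueField P] IsLocalRing.ResidueField P))
      (ModuleCat.of R R) 1)) (q : Ideal P) [q.IsPrime]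
    (hq : IsGorensteinRing (q.ResidueField ⊗[P] Q)) :
    ∃ φ : Q →ₗ[P] P, Submodule.span Q {φ} = ⊤ := by
  have : Module.Free P Q := .of_basis b
  have : Module.Finite P Q := .of_basis b
  have : Module.Finite Q (Q →ₗ[P] P) := .of_restrictScalars_finite P Q _
  have := finite_maximalSpectrum_of_isLocalRing P Q
  have := free_dual_tensor_dual hb h
  obtain ⟨φ, hφ⟩ := exists_generator_up_to_denominators_of_isGorensteinRing q hq
  refine exists_span_singleton_eq_top_of_forall_isMaximal fun m hm x y hx ↦
    mem_sup_span_singleton_of_tmul_symm (I := IsLocalRing.maximalIdeal P) (fun x y ↦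
      mem_smul_top_of_forall_apply_mem fun c ↦ ?_) m ?_ hx y
  · rw [map_sub]
    exact IsLocalRing.le_maximalIdeal Ideal.IsPrime.ne_top'
      (apply_tmul_sub_apply_tmul_mem q hφ c x y)
  · have := Ideal.isMaximal_comap_of_isIntegral_of_isMaximal (R := P) m
    rw [Ideal.map_le_iff_le_comap, IsLocalRing.eq_maximalIdeal this]

lemma isGorensteinRing_of_span_dual_eq_top (hb : ∀ i, bR i = algebraMap Q R (b i))
    {φ : Q →ₗ[P] P} (hφ : Submodule.span Q {φ} = ⊤) : IsGorensteinRing R := by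
  have : Module.Finite (IsLocalRing.ResidueField P) R := .of_basis bR
  have : IsNoetherianRing R := .of_finite (IsLocalRing.ResidueField P) R
  have : Module.Injective R R := by
    refine injective_self_of_span_dual_eq_top (φ := dualBaseChange b bR φ)
      (eq_top_iff.2 fun ψ _ ↦ ?_)
    obtain ⟨χ, rfl⟩ := dualBaseChange_surjective (b := b) (bA := bR)
      IsLocalRing.residue_surjective ψ
    obtain ⟨x, rfl⟩ := Submodule.mem_span_singleton.1
      (hφ ▸ Submodule.mem_top : χ ∈ Submodule.span Q {φ})
    rw [dualBaseChange_smul hb]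
    exact Submodule.smul_mem _ _ (Submodule.mem_span_singleton_self _)
  exact isGorensteinRing_of_injective

end Main

/-- Let `(P, 𝔭, k)` be a commutative noetherian local ring and `P → Q` a
homomorphism of commutative rings such that `Q` is a finite free `P`-module, and suppose
some fiber `k(q) ⊗_P Q` is Gorenstein.  Set `R = Q/𝔭Q`.  If `Ext^1_R(Hom_k(R, k), R) = 0`
then `R` is Gorenstein and the `P`-algebra `Q` is Frobenius. -/
theorem isGorenstein_and_frobenius_of_ext_one_vanishes
    (P Q : Type) [CommRing P] [IsNoetherianRing P] [IsLocalRing P]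
    [CommRing Q] [Algebra P Q] [Module.Finite P Q] [Module.Free P Q]
    (hfiber : ∃ (q : Ideal P) (hq : q.IsPrime),
      letI := hq
      IsGorensteinRing ((IsLocalRing.ResidueField (Localization.AtPrime q)) ⊗[P] Q)) :
    let k := P ⧸ IsLocalRing.maximalIdeal P
    let R := Q ⧸ (IsLocalRing.maximalIdeal P).map (algebraMap P Q)
    letI : Algebra k R :=
      (Ideal.quotientMap ((IsLocalRing.maximalIdeal P).map (algebraMap P Q))
        (algebraMap P Q) Ideal.le_comap_map).toAlgebra
    Limits.IsZero (((Ext R (ModuleCat R) 1).obj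
        (Opposite.op (ModuleCat.of R (R →ₗ[k] k)))).obj (ModuleCat.of R R)) →
      IsGorensteinRing R ∧ IsFrobeniusAlgebra P Q := by
  intro k R hExt
  obtain ⟨q, hq, hfib⟩ := hfiber
  let b := Module.Free.chooseBasis P Q
  have hsub := (isZero_ext_succ_iff _ _ 0).1 hExt
  let : Algebra (IsLocalRing.ResidueField P) R :=
    (Ideal.quotientMap ((IsLocalRing.maximalIdeal P).map (algebraMap P Q))
      (algebraMap P Q) Ideal.le_comap_map).toAlgebra
  have : IsScalarTower P (IsLocalRing.ResidueField P) R := .of_algebraMap_eq fun _ ↦ rfl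
  let bR : Module.Basis _ (IsLocalRing.ResidueField P) R :=
    (IsLocalRing.basisQuotient b).mapCoeffs (RingEquiv.refl (IsLocalRing.ResidueField P)) <| by
      rintro ⟨c⟩ ⟨x⟩
      exact congrArg (Ideal.Quotient.mk _) (Algebra.smul_def c x).symm
  have hb (i) : bR i = algebraMap Q R (b i) :=
    (Module.Basis.mapCoeffs_apply _ _ _ i).trans (IsLocalRing.basisQuotient_apply b i)
  obtain ⟨φ, hφ⟩ := exists_span_dual_eq_top_of_subsingleton_ext hb hsub q hfib
  exact ⟨isGorensteinRing_of_span_dual_eq_top hb hφ, inferInstance, inferInstance, φ,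
    bijective_of_span_dual_eq_top hφ⟩
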